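/- Let f : ℝⁿ → ℝ be real analytic and nonnegative, and let p satisfy f(p) = 0 and ∇f(p) = 0. Let S denote the set of critical points of f. Then there exist a neighborhood U of p and constants C > 0 and α ≥ 2 such that f(x) ≥ C · dist(x, S)^α for all x ∈ U, where dist(x, S) = inf{‖x − z‖ : z ∈ S}. -/

import Mathlib

open Filter Topology
open scoped NNReal ENNReal

abbrev LojB := lp (fun _ : ℕ => ℝ) 1

theorem loj_memlp {b : ℕ → ℝ} : Memℓp b 1 ↔ Summable fun k => |b k| := by
  rw [memℓp_gen_iff (by simp)]
  simp

theorem loj_summable (b : LojB) : Summable fun k => |b k| := loj_memlp.1 b.2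

theorem loj_norm (b : LojB) : ‖b‖ = ∑' k, |b k| := by
  rw [lp.norm_eq_tsum_rpow (by simp)]
  simp

theorem loj_ev_summable (b : LojB) {s : ℝ} (hs : |s| ≤ 1) :
    Summable fun k => b k * s ^ k := by
  refine Summable.of_norm_bounded (loj_summable b) fun k => ?_
  rw [norm_mul, norm_pow, Real.norm_eq_abs, Real.norm_eq_abs]
  exact mul_le_of_le_one_right (abs_nonneg _) (pow_le_one₀ (abs_nonneg _) hs)

/-- evaluation -/
noncomputable def lojEv (s : ℝ) (hs : |s| ≤ 1) : LojB →L[ℝ] ℝ :=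
  LinearMap.mkContinuous
    { toFun := fun b => ∑' k, b k * s ^ k
      map_add' := fun a b => by
        rw [← (loj_ev_summable a hs).tsum_add (loj_ev_summable b hs)]
        simp [add_mul]
      map_smul' := fun c b => by
        simp [mul_assoc, tsum_mul_left] } 1 (fun b => by
      rw [one_mul, loj_norm]
      refine tsum_of_norm_bounded (loj_summable b).hasSum fun k => ?_
      rw [norm_mul, norm_pow, Real.norm_eq_abs, Real.norm_eq_abs]
      exact mul_le_of_le_one_right (abs_nonneg _) (pow_le_one₀ (abs_nonneg _) hs))

theorem lojEv_apply (s : ℝ) (hs : |s| ≤ 1) (b : LojB) : lojEv s hs b = ∑' k, b k * s ^ k := rfl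

theorem lojEv_single (s : ℝ) (hs : |s| ≤ 1) (k : ℕ) (c : ℝ) :
    lojEv s hs (lp.single 1 k c) = c * s ^ k := by
  rw [lojEv_apply, tsum_eq_single k]
  · simp
  · intro j hj
    simp [hj]

theorem loj_hasSum {V : Type*} [NormedAddCommGroup V] [CompleteSpace V] (G : ℕ → V)
    (h : Summable fun k => ‖G k‖) : HasSum G (∑' k, G k) := h.of_norm.hasSum

theorem tsum_of_norm_bounded_aux {V : Type*} [NormedAddCommGroup V] {G : ℕ → V} {q : V}
    (hq : HasSum G q) (h : Summable fun k => ‖G k‖) : ‖q‖ ≤ ∑' k, ‖G k‖ := by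
  rw [← hq.tsum_eq]
  exact norm_tsum_le_tsum_norm h

theorem loj_lift_aux {E : Type*} [NormedAddCommGroup E] [NormedSpace ℝ E]
    {B : Type*} [NormedAddCommGroup B] [NormedSpace ℝ B] [CompleteSpace B]
    (σ : ℕ → ℝ →L[ℝ] B) (hσ : ∀ k c, ‖σ k c‖ ≤ |c|)
    (M : ∀ k l : ℕ, ContinuousMultilinearMap ℝ (fun _ : Fin l => E) ℝ) (r : ℝ≥0) (hr0 : 0 < r)
    (hsum : Summable fun s : ℕ × ℕ => ‖M s.2 s.1‖ * (r:ℝ) ^ s.1 * (r:ℝ) ^ s.2) :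
    ∃ F : E → B, AnalyticAt ℝ F 0 ∧
      ∀ x : E, ‖x‖ < r → ∀ t : ℝ, |t| ≤ r →
        ∀ ev : B →L[ℝ] ℝ, (∀ k c, ev (σ k c) = c * (t / r) ^ k) → ev (F x) = ∑' k, ∑' l, t ^ k * M k l (fun _ => x) := by
  let G : ∀ l k : ℕ, ContinuousMultilinearMap ℝ (fun _ : Fin l => E) B := fun l k =>
    (r : ℝ) ^ k • (σ k).compContinuousMultilinearMap (M k l)
  have hGa : ∀ l k v, G l k v = (r:ℝ)^k • σ k (M k l v) := fun l k v => rfl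
  have hG : ∀ l k, ‖G l k‖ ≤ ‖M k l‖ * r ^ k := by
    intro l k
    refine ContinuousMultilinearMap.opNorm_le_bound (by positivity) fun v => ?_
    rw [hGa, norm_smul, norm_pow, mul_comm _ ((r:ℝ)^k), mul_assoc]
    simp only [NNReal.norm_eq]
    gcongr
    exact (hσ _ _).trans ((M k l).le_opNorm v)
  clear_value G
  have hsum2 : Summable fun s : ℕ × ℕ => ‖G s.1 s.2‖ * (r:ℝ) ^ s.1 := by
    refine Summable.of_nonneg_of_le (fun _ => by positivity) (fun s => ?_) hsum
    rw [mul_right_comm]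
    gcongr
    exact hG _ _
  have hsum3 : ∀ l, Summable fun k => ‖G l k‖ := by
    intro l
    have := hsum2.prod_factor l
    have hne : (r:ℝ) ^ l ≠ 0 := by positivity
    have h8 := this.mul_right (((r:ℝ) ^ l)⁻¹)
    refine h8.congr fun k => ?_
    exact mul_inv_cancel_right₀ hne _
  have hqq : ∃ q : FormalMultilinearSeries ℝ E B, ∀ l, HasSum (G l) (q l) :=
    ⟨fun l => ∑' k, G l k, fun l => loj_hasSum (G l) (hsum3 l)⟩
  obtain ⟨q, hqG⟩ := hqq
  have hqr : (r : ℝ≥0∞) ≤ q.radius := by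
    refine q.le_radius_of_summable_norm ?_
    refine Summable.of_nonneg_of_le (fun _ => by positivity) (fun l => ?_) hsum2.prod
    have h9 : ‖q l‖ ≤ ∑' k, ‖G l k‖ := tsum_of_norm_bounded_aux (hqG l) (hsum3 l)
    have h10 : ∑' k, ‖G l k‖ * (r:ℝ) ^ l = (∑' k, ‖G l k‖) * (r:ℝ) ^ l := tsum_mul_right
    exact (mul_le_mul_of_nonneg_right h9 (by positivity)).trans_eq h10.symm
  have hq0 : 0 < q.radius := lt_of_lt_of_le (by exact_mod_cast hr0) hqr
  have hq := q.hasFPowerSeriesOnBall hq0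
  refine ⟨q.sum, hq.analyticAt, ?_⟩
  intro x hx t ht ev hev
  have hxn : ‖x‖₊ < r := hx
  have hxq : x ∈ Metric.eball (0:E) q.radius := by
    rw [mem_eball_zero_iff]
    refine lt_of_lt_of_le ?_ hqr
    exact ENNReal.coe_lt_coe.2 hxn
  have h1 : HasSum (fun l => ev (q l fun _ => x)) (ev (q.sum x)) :=
    (ev).hasSum (q.hasSum hxq)
  have hterm : ∀ l k, ev (G l k fun _ => x) = t^k * M k l (fun _ => x) := by
    intro l k
    rw [hGa, map_smul, hev, smul_eq_mul, div_pow]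
    have : (r:ℝ)^k ≠ 0 := by positivity
    field_simp
  have h2 : ∀ l, HasSum (fun k => t^k * M k l (fun _ => x)) (ev (q l fun _ => x)) := by
    intro l
    have h4 := (ev).hasSum (ContinuousMultilinearMap.hasSum_eval (hqG l) (fun _ => x))
    simpa only [hterm] using h4
  have hsumA : Summable (Function.uncurry fun l k : ℕ => t^k * M k l (fun _ => x)) := by
    refine Summable.of_norm_bounded hsum fun s => ?_
    simp only [Function.uncurry]
    rw [norm_mul, norm_pow, Real.norm_eq_abs, mul_comm]
    have := (M s.2 s.1).le_opNorm (fun _ => x)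
    simp only [Finset.prod_const, Finset.card_univ, Fintype.card_fin] at this
    gcongr
    exact this.trans (by gcongr)
  rw [← h1.tsum_eq, hsumA.tsum_comm]
  exact tsum_congr fun l => (h2 l).tsum_eq.symm

theorem loj_lift {E : Type*} [NormedAddCommGroup E] [NormedSpace ℝ E] (f : E × ℝ → ℝ)
    (hf : AnalyticAt ℝ f 0) : ∃ ρ : ℝ, 0 < ρ ∧ ∃ F : E → LojB, AnalyticAt ℝ F 0 ∧
      ∀ᶠ x in 𝓝 (0 : E), ∀ t : ℝ, |t| ≤ ρ → f (x, t) = ∑' k, F x k * (t / ρ) ^ k := by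
  obtain ⟨p, R, hp⟩ := hf
  obtain ⟨R', hR'0, hR'⟩ := ENNReal.lt_iff_exists_nnreal_btwn.1 hp.r_pos
  have hR'0 : 0 < R' := by exact_mod_cast hR'0
  set r : ℝ≥0 := R' / 2 with hr
  have hr0 : 0 < r := by positivity
  have hrr : (r + r : ℝ≥0∞) < R := by
    have : r + r = R' := by rw [hr]; exact add_halves R'
    rw [← ENNReal.coe_add, this]; exact hR'
  have hrp : (r + r : ℝ≥0∞) < p.radius := hrr.trans_le hp.r_le
  -- summability
  have hsum1 : Summable fun s : ℕ × ℕ => ‖p.changeOriginSeries s.2 s.1‖ * (r:ℝ) ^ s.1 * (r:ℝ) ^ s.2 := by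
    have h1 := p.changeOriginSeries_summable_aux₁ hrp
    have h2 : Summable fun s : (Σ _ : ℕ, ℕ) => ‖p.changeOriginSeries s.1 s.2‖₊ * r ^ s.2 * r ^ s.1 := by
      have h3 := (Equiv.sigmaAssoc (fun (_ : ℕ) (_ : ℕ) => Unit)).symm
      have h4 := (Equiv.sigmaAssoc (γ := fun (k l : ℕ) => { s : Finset (Fin (k + l)) // s.card = l })).summable_iff.2 h1
      have h5 := (NNReal.summable_sigma.1 h4).2
      refine NNReal.summable_of_le (fun s => ?_) h5
      simp only [Function.comp, Equiv.sigmaAssoc, Equiv.coe_fn_mk]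
      rw [NNReal.tsum_mul_right, NNReal.tsum_mul_right]
      gcongr
      exact p.nnnorm_changeOriginSeries_le_tsum _ _
    have h6 := ((Equiv.prodComm ℕ ℕ).trans (Equiv.sigmaEquivProd ℕ ℕ).symm).summable_iff.2 h2
    have h7 := NNReal.summable_coe.2 h6
    exact h7
  let e : E × ℝ := (0, 1)
  have he : ‖e‖ = 1 := by simp [e]
  let M : ∀ k l : ℕ, ContinuousMultilinearMap ℝ (fun _ : Fin l => E) ℝ := fun k l =>
    (ContinuousMultilinearMap.apply ℝ (fun _ : Fin k => E × ℝ) ℝ (fun _ => e)).compContinuousMultilinearMap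
      ((p.changeOriginSeries k l).compContinuousLinearMap (fun _ => ContinuousLinearMap.inl ℝ E ℝ))
  have hMa : ∀ k l (v : Fin l → E), M k l v = p.changeOriginSeries k l (fun i => (v i, 0)) (fun _ => e) :=
    fun k l v => rfl
  have hM : ∀ k l, ‖M k l‖ ≤ ‖p.changeOriginSeries k l‖ := by
    intro k l
    refine ContinuousMultilinearMap.opNorm_le_bound (norm_nonneg (p.changeOriginSeries k l)) fun v => ?_
    rw [hMa]
    refine (ContinuousMultilinearMap.le_opNorm _ _).trans ?_
    simp only [he, Finset.prod_const_one, mul_one]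
    refine (ContinuousMultilinearMap.le_opNorm _ _).trans ?_
    simp
  have hsum2 : Summable fun s : ℕ × ℕ => ‖M s.2 s.1‖ * (r:ℝ) ^ s.1 * (r:ℝ) ^ s.2 := by
    refine Summable.of_nonneg_of_le (fun _ => by positivity) (fun s => ?_) hsum1
    gcongr
    exact hM _ _
  obtain ⟨F, hF, hFe⟩ := loj_lift_aux
    (fun k => lp.singleContinuousLinearMap ℝ (fun _ : ℕ => ℝ) 1 k)
    (fun k c => by simp [lp.singleContinuousLinearMap_apply, lp.norm_single]) M r hr0 hsum2
  refine ⟨r, hr0, F, hF, ?_⟩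
  clear_value M
  filter_upwards [Metric.ball_mem_nhds (0:E) (show (0:ℝ) < r from hr0)] with x hx t ht
  have hx : ‖x‖ < r := by simpa using hx
  have hxn : ‖x‖₊ < r := hx
  have hs : |t / r| ≤ 1 := by
    rw [abs_div, NNReal.abs_eq]; exact (div_le_one (NNReal.coe_pos.2 hr0)).2 ht
  rw [← lojEv_apply _ hs, hFe x hx t ht (lojEv (t / r) hs) (fun k c => lojEv_single _ hs k c)]
  -- other side
  have hx0 : ‖((x, 0) : E × ℝ)‖₊ = ‖x‖₊ := by simp
  have ht0 : ‖((0, t) : E × ℝ)‖₊ = ‖t‖₊ := by simp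
  have htn : ‖t‖₊ ≤ r := ht
  have hlt : (‖((x, 0) : E × ℝ)‖₊ + ‖((0, t) : E × ℝ)‖₊ : ℝ≥0∞) < p.radius := by
    rw [hx0, ht0]
    refine lt_of_le_of_lt ?_ hrp
    gcongr
  have hfx : f (x, t) = (p.changeOrigin (x, 0)).sum (0, t) := by
    rw [p.changeOrigin_eval hlt]
    have hmem : ((x, t) : E × ℝ) ∈ Metric.eball (0 : E × ℝ) R := by
      rw [mem_eball_zero_iff]
      refine lt_of_le_of_lt ?_ hrr
      have : ((x,t) : E × ℝ) = (x,0) + (0,t) := by simp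
      rw [this]
      refine (enorm_add_le _ _).trans ?_
      have a1 : ‖((x, 0) : E × ℝ)‖ₑ = ‖x‖₊ := by rw [← hx0]; rfl
      have a2 : ‖((0, t) : E × ℝ)‖ₑ = ‖t‖₊ := by rw [← ht0]; rfl
      rw [a1, a2]
      gcongr
    have := hp.sum hmem
    simpa using this
  have hxr : ((x, 0) : E × ℝ) ∈ Metric.eball (0 : E × ℝ) p.radius :=
    mem_eball_zero_iff.2 ((le_add_right le_rfl).trans_lt hlt)
  have hco : ∀ k, HasSum (fun l => t^k * M k l (fun _ => x)) (p.changeOrigin (x,0) k (fun _ => (0,t))) := by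
    intro k
    have h5 := (p.hasFPowerSeriesOnBall_changeOrigin k hlt.pos).hasSum hxr
    rw [zero_add] at h5
    have h6 := ContinuousMultilinearMap.hasSum_eval h5 (fun _ => ((0, t) : E × ℝ))
    refine h6.congr_fun fun l => ?_
    rw [hMa]
    have : (fun _ : Fin k => ((0, t) : E × ℝ)) = fun i => (fun _ => t) i • (fun _ => e) i := by
      ext <;> simp [e]
    rw [this, ContinuousMultilinearMap.map_smul_univ]
    simp
  rw [hfx, FormalMultilinearSeries.sum]
  exact tsum_congr fun k => (hco k).tsum_eq.symm

open Filter Topology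
open scoped NNReal ENNReal ContDiff

section
variable {B : Type*} [NormedAddCommGroup B] [NormedSpace ℝ B]

noncomputable def lojD (T : B →L[ℝ] B) (u : B) (m : ℕ) : B × (Fin m → ℝ) →L[ℝ] B :=
  (T ^ m) ∘L (ContinuousLinearMap.fst ℝ B (Fin m → ℝ)) +
    ∑ i : Fin m, (ContinuousLinearMap.smulRight
      ((ContinuousLinearMap.proj i : (Fin m → ℝ) →L[ℝ] ℝ) ∘L ContinuousLinearMap.snd ℝ B (Fin m → ℝ))
      ((T ^ (i : ℕ)) u))

theorem lojD_apply (T : B →L[ℝ] B) (u : B) (m : ℕ) (V : B) (b : Fin m → ℝ) :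
    lojD T u m (V, b) = (T ^ m) V + ∑ i : Fin m, b i • (T ^ (i : ℕ)) u := by
  simp [lojD]

theorem lojD_injective (T : B →L[ℝ] B) (c : B →L[ℝ] ℝ) (hcT : ∀ b, c (T b) = 0)
    (hT : Function.Injective T) (u : B) (hu : c u ≠ 0) (m : ℕ) :
    ∀ (V : B) (b : Fin m → ℝ), lojD T u m (V, b) = 0 → V = 0 ∧ b = 0 := by
  induction m with
  | zero => 
    intro V b h
    rw [lojD_apply] at h
    refine ⟨by simpa using h, Subsingleton.elim _ _⟩
  | succ m ih =>
    intro V b h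
    have key : lojD T u (m+1) (V, b) = b 0 • u + T (lojD T u m (V, fun i => b i.succ)) := by
      rw [lojD_apply, lojD_apply, Fin.sum_univ_succ, map_add, map_sum]
      simp only [pow_succ', mul_apply_eq_comp, Fin.val_succ, Fin.val_zero, pow_zero,
        one_apply_eq_self, map_smul]
      abel
    rw [key] at h
    have h0 : b 0 = 0 := by
      have := congrArg c h
      rw [map_add, hcT, map_smul, map_zero, add_zero, smul_eq_mul] at this
      exact (mul_eq_zero.1 this).resolve_right hu
    rw [h0, zero_smul, zero_add] at h
    have h1 := hT (h.trans (map_zero T).symm)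
    obtain ⟨hV, hb⟩ := ih _ _ h1
    refine ⟨hV, ?_⟩
    ext i
    refine Fin.cases h0 (fun j => ?_) i
    exact congrFun hb j

theorem lojD_surjective (T : B →L[ℝ] B) (c : B →L[ℝ] ℝ)
    (hT : ∀ b, c b = 0 → ∃ b', T b' = b) (u : B) (hu : c u ≠ 0) (m : ℕ) (w : B) :
    ∃ (V : B) (b : Fin m → ℝ), lojD T u m (V, b) = w := by
  induction m with
  | zero => exact ⟨w, 0, by simp [lojD_apply]⟩
  | succ m ih =>
    obtain ⟨V, b, h⟩ := ih
    obtain ⟨V', hV'⟩ := hT (V - (c V / c u) • u) (by simp [hu])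
    refine ⟨V', Fin.snoc b (c V / c u), ?_⟩
    rw [← h, lojD_apply, lojD_apply, Fin.sum_univ_castSucc]
    simp only [Fin.snoc_castSucc, Fin.snoc_last, Fin.val_castSucc, Fin.val_last, pow_succ,
      mul_apply_eq_comp, hV', map_sub, map_smul]
    abel

theorem loj_prep_abstract [CompleteSpace B] {E : Type*} [NormedAddCommGroup E] [NormedSpace ℝ E]
    (T : B →L[ℝ] B) (c : B →L[ℝ] ℝ) (hcT : ∀ b, c (T b) = 0)
    (hTi : Function.Injective T)
    (hTs : ∀ b, c b = 0 → ∃ b', T b' = b) (u : B) (hu : c u ≠ 0) (m : ℕ)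
    (F : E → B) (hF : AnalyticAt ℝ F 0) (hF0 : F 0 = (T ^ m) u) :
    ∃ (U : E → B) (a : E → Fin m → ℝ), AnalyticAt ℝ U 0 ∧ (∀ i, AnalyticAt ℝ (fun x => a x i) 0) ∧
      U 0 = u ∧ ∀ᶠ x in 𝓝 0, F x = (T ^ m) (U x) + ∑ i : Fin m, a x i • (T ^ (i : ℕ)) (U x) := by
  let Φ : B × (Fin m → ℝ) → B := fun q => (T ^ m) q.1 + ∑ i : Fin m, q.2 i • (T ^ (i : ℕ)) q.1
  have hΦ : ContDiffAt ℝ ω Φ (u, 0) := by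
    apply ContDiff.contDiffAt
    fun_prop
  have hΦ0 : Φ (u, 0) = F 0 := by simp [Φ, hF0]
  let D : (B × (Fin m → ℝ)) ≃L[ℝ] B := ContinuousLinearEquiv.ofBijective (lojD T u m)
    (by
      rw [LinearMap.ker_eq_bot']
      rintro ⟨V, b⟩ h
      obtain ⟨h1, h2⟩ := lojD_injective T c hcT hTi u hu m V b h
      simp [h1, h2])
    (by
      rw [LinearMap.range_eq_top]
      intro w
      obtain ⟨V, b, h⟩ := lojD_surjective T c hTs u hu m w
      exact ⟨(V, b), h⟩)
  have hD : HasFDerivAt Φ (D : (B × (Fin m → ℝ)) →L[ℝ] B) (u, 0) := by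
    have h1 : HasFDerivAt Φ ((T ^ m) ∘L (ContinuousLinearMap.fst ℝ B (Fin m → ℝ)) +
      ∑ i : Fin m, (((u, (0 : Fin m → ℝ)).2 i) • ((T ^ (i : ℕ)) ∘L (ContinuousLinearMap.fst ℝ B (Fin m → ℝ))) + 
        (ContinuousLinearMap.smulRight
      ((ContinuousLinearMap.proj i : (Fin m → ℝ) →L[ℝ] ℝ) ∘L ContinuousLinearMap.snd ℝ B (Fin m → ℝ))
      ((T ^ (i : ℕ)) u)))) (u, 0) := by
      apply HasFDerivAt.add
      · exact ((T ^ m) ∘L (ContinuousLinearMap.fst ℝ B (Fin m → ℝ))).hasFDerivAt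
      · apply HasFDerivAt.fun_sum
        intro i _
        exact HasFDerivAt.fun_smul
          (((ContinuousLinearMap.proj i : (Fin m → ℝ) →L[ℝ] ℝ) ∘L ContinuousLinearMap.snd ℝ B (Fin m → ℝ)).hasFDerivAt)
          (((T ^ (i:ℕ)) ∘L (ContinuousLinearMap.fst ℝ B (Fin m → ℝ))).hasFDerivAt)
    have h2 : (D : (B × (Fin m → ℝ)) →L[ℝ] B) = lojD T u m := 
      ContinuousLinearEquiv.coe_ofBijective _ _ _
    rw [h2]
    simpa only [lojD, Pi.zero_apply, zero_smul, zero_add] using h1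
  have hn : (ω : WithTop ℕ∞) ≠ 0 := by simp
  let g := hΦ.localInverse hD hn
  have hg : ContDiffAt ℝ ω g (F 0) := hΦ0 ▸ hΦ.to_localInverse hD hn
  have hg0 : g (F 0) = (u, 0) := by rw [← hΦ0]; exact hΦ.localInverse_apply_image hD hn
  have hgr : ∀ᶠ y in 𝓝 (F 0), Φ (g y) = y := by
    rw [← hΦ0]
    exact (hΦ.hasStrictFDerivAt' hD hn).eventually_right_inverse
  have hgF : AnalyticAt ℝ (fun x => g (F x)) 0 := by
    have : AnalyticAt ℝ g (F 0) := hg.analyticAt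
    exact this.fun_comp hF
  refine ⟨fun x => (g (F x)).1, fun x => (g (F x)).2, ?_, ?_, ?_, ?_⟩
  · exact ((ContinuousLinearMap.fst ℝ B (Fin m → ℝ)).analyticAt _).fun_comp hgF
  · intro i
    exact (((ContinuousLinearMap.proj i : (Fin m → ℝ) →L[ℝ] ℝ) ∘L ContinuousLinearMap.snd ℝ B (Fin m → ℝ)).analyticAt _).fun_comp hgF
  · simp [hg0]
  · have := hF.continuousAt.eventually hgr
    filter_upwards [this] with x hx
    exact hx.symm
end

theorem loj_shift_summable (b : LojB) : Summable fun k : ℕ => |if k = 0 then 0 else b (k-1)| := by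
  rw [← summable_nat_add_iff 1]
  simpa using loj_summable b

noncomputable def lojT : LojB →L[ℝ] LojB :=
  LinearMap.mkContinuous
    { toFun := fun b => ⟨fun k => if k = 0 then 0 else b (k-1), loj_memlp.2 (loj_shift_summable b)⟩
      map_add' := fun a b => by
        ext k
        change _ = (if k = 0 then (0:ℝ) else a (k-1)) + (if k = 0 then (0:ℝ) else b (k-1))
        by_cases hk : k = 0 <;> simp [hk]
      map_smul' := fun c b => by
        ext k
        by_cases hk : k = 0 <;> simp [hk] } 1 (fun b => by
      rw [one_mul, loj_norm, loj_norm]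
      have := (loj_shift_summable b).tsum_eq_zero_add
      refine le_of_eq (Eq.trans this ?_)
      simp)

theorem lojT_zero (b : LojB) : lojT b 0 = 0 := rfl
theorem lojT_succ (b : LojB) (k : ℕ) : lojT b (k+1) = b k := rfl

theorem lojT_inj : Function.Injective lojT := by
  intro a b h
  ext k
  rw [← lojT_succ, h, lojT_succ]

noncomputable def lojTail (b : LojB) : LojB :=
  ⟨fun k => b (k+1), loj_memlp.2 ((summable_nat_add_iff 1).2 (loj_summable b))⟩

theorem lojTail_apply (b : LojB) (k : ℕ) : lojTail b k = b (k+1) := rfl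

theorem lojT_tail (b : LojB) (hb : b 0 = 0) : lojT (lojTail b) = b := by
  ext k
  cases k with
  | zero => rw [lojT_zero, hb]
  | succ k => rw [lojT_succ, lojTail_apply]

theorem loj_order (m : ℕ) : ∀ b : LojB, (∀ j < m, b j = 0) → b m ≠ 0 → 
    ∃ u : LojB, b = (lojT ^ m) u ∧ u 0 ≠ 0 := by
  induction m with
  | zero => intro b _ h; exact ⟨b, by simp, h⟩
  | succ m ih =>
    intro b h1 h2
    obtain ⟨u, hu, hu0⟩ := ih (lojTail b) (fun j hj => h1 (j+1) (by omega)) h2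
    refine ⟨u, ?_, hu0⟩
    rw [pow_succ', mul_apply_eq_comp, ← hu, lojT_tail _ (h1 0 (by omega))]

theorem lojEv_T (s : ℝ) (hs : |s| ≤ 1) (b : LojB) : lojEv s hs (lojT b) = s * lojEv s hs b := by
  rw [lojEv_apply, lojEv_apply, (loj_ev_summable (lojT b) hs).tsum_eq_zero_add, lojT_zero,
    ← tsum_mul_left]
  simp only [lojT_succ, zero_mul, zero_add]
  exact tsum_congr fun k => by ring

theorem lojEv_T_pow (s : ℝ) (hs : |s| ≤ 1) (b : LojB) (m : ℕ) :
    lojEv s hs ((lojT ^ m) b) = s ^ m * lojEv s hs b := by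
  induction m with
  | zero => simp
  | succ m ih => rw [pow_succ', mul_apply_eq_comp, lojEv_T, ih]; ring

theorem lojEv_lower (s : ℝ) (hs : |s| ≤ 1) (b : LojB) : |lojEv s hs b - b 0| ≤ |s| * ‖b‖ := by
  have h1 : lojEv s hs b - b 0 = s * lojEv s hs (lojTail b) := by
    rw [lojEv_apply, lojEv_apply, (loj_ev_summable b hs).tsum_eq_zero_add, ← tsum_mul_left]
    simp only [pow_zero, mul_one, add_sub_cancel_left, lojTail_apply]
    exact tsum_congr fun k => by ring
  rw [h1, abs_mul]
  gcongr
  have h2 : ‖lojTail b‖ ≤ ‖b‖ := by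
    rw [loj_norm, loj_norm, (loj_summable b).tsum_eq_zero_add]
    simp only [lojTail_apply]
    linarith [abs_nonneg (b 0)]
  have h3 : ‖lojEv s hs (lojTail b)‖ ≤ 1 * ‖lojTail b‖ := by
    apply ContinuousLinearMap.le_of_opNorm_le
    exact LinearMap.mkContinuous_norm_le _ zero_le_one _
  rw [Real.norm_eq_abs] at h3
  linarith

noncomputable def lojC : LojB →L[ℝ] ℝ := lojEv 0 (by simp)

theorem lojC_apply (b : LojB) : lojC b = b 0 := by
  have := lojEv_lower 0 (by simp) b
  simp only [abs_zero, zero_mul, abs_nonpos_iff] at this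
  exact sub_eq_zero.1 this

/-- Weierstrass preparation -/
theorem loj_weierstrass {E : Type*} [NormedAddCommGroup E] [NormedSpace ℝ E] (f : E × ℝ → ℝ)
    (hf : AnalyticAt ℝ f 0) (hne : ¬ ∀ᶠ t in 𝓝 (0:ℝ), f (0, t) = 0) :
    ∃ (m : ℕ) (a : Fin m → E → ℝ) (u : E × ℝ → ℝ) (ε : ℝ), 0 < ε ∧ (∀ i, AnalyticAt ℝ (a i) 0) ∧
      (∀ᶠ z in 𝓝 (0 : E × ℝ), ε ≤ |u z| ∧ f z = u z * (z.2 ^ m + ∑ i : Fin m, a i z.1 * z.2 ^ (i:ℕ))) := by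
  obtain ⟨ρ, hρ, F, hF, hFf⟩ := loj_lift f hf
  have hF0 : F 0 ≠ 0 := by
    intro h0
    apply hne
    have h1 := hFf.self_of_nhds
    filter_upwards [Metric.closedBall_mem_nhds (0:ℝ) hρ] with t ht
    rw [h1 t (by simpa using ht), h0]
    simp
  have hex : ∃ m, F 0 m ≠ 0 := by
    by_contra! h
    apply hF0
    ext k
    simp [h k]
  classical
  let m := Nat.find hex
  obtain ⟨u, hu, hu0⟩ := loj_order m (F 0) (fun j hj => by simpa using Nat.find_min hex hj) (Nat.find_spec hex)
  obtain ⟨U, a, hU, ha, hU0, hUa⟩ := loj_prep_abstract lojT lojC (fun b => by rw [lojC_apply, lojT_zero])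
    lojT_inj (fun b hb => ⟨lojTail b, lojT_tail b (by rwa [lojC_apply] at hb)⟩) u (by rwa [lojC_apply]) m F hF hu
  have hρm : ρ ^ m ≠ 0 := by positivity
  refine ⟨m, fun i x => a x i * (ρ ^ m / ρ ^ (i:ℕ)), fun z => (∑' k, U z.1 k * (z.2 / ρ) ^ k) / ρ ^ m, 
    |u 0| / 2 / ρ ^ m, by positivity, fun i => (ha i).mul analyticAt_const, ?_⟩
  have hfst : Tendsto (fun z : E × ℝ => z.1) (𝓝 0) (𝓝 0) := continuous_fst.tendsto _
  have hsnd : Tendsto (fun z : E × ℝ => z.2) (𝓝 0) (𝓝 0) := continuous_snd.tendsto _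
  have hlow : Tendsto (fun z : E × ℝ => |lojC (U z.1)| - |z.2 / ρ| * ‖U z.1‖) (𝓝 0) (𝓝 (|lojC (U 0)| - |0 / ρ| * ‖U 0‖)) := by
    have hU1 : Tendsto (fun z : E × ℝ => U z.1) (𝓝 0) (𝓝 (U 0)) := hU.continuousAt.tendsto.comp hfst
    exact ((lojC.continuous.tendsto _).comp hU1).abs.sub ((hsnd.div_const ρ).abs.mul hU1.norm)
  have hlow2 : ∀ᶠ z in 𝓝 (0 : E × ℝ), |u 0| / 2 < |lojC (U z.1)| - |z.2 / ρ| * ‖U z.1‖ := by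
    apply hlow.eventually_const_lt
    rw [hU0, lojC_apply]
    have : 0 < |u 0| := abs_pos.2 hu0
    rw [zero_div, abs_zero, zero_mul, sub_zero]
    linarith
  filter_upwards [hlow2, hfst.eventually hFf, hfst.eventually hUa, hsnd.eventually (Metric.closedBall_mem_nhds (0:ℝ) hρ)] with z h1 h2 h3 h4
  have h4' : |z.2| ≤ ρ := by simpa using h4
  have hs : |z.2 / ρ| ≤ 1 := by
    rw [abs_div, abs_of_pos hρ]; exact (div_le_one hρ).2 h4'
  rw [← lojEv_apply _ hs]
  constructor
  · rw [abs_div, abs_of_pos (by positivity : 0 < ρ ^ m)]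
    gcongr
    have h5 := lojEv_lower _ hs (U z.1)
    rw [lojC_apply] at h1
    have := abs_sub_abs_le_abs_sub (U z.1 0) (lojEv _ hs (U z.1))
    rw [abs_sub_comm] at this
    linarith
  · have h6 := h2 z.2 h4'
    rw [← lojEv_apply _ hs, h3, map_add, map_sum, lojEv_T_pow] at h6
    have h7 : f z = f (z.1, z.2) := rfl
    rw [h7, h6]
    simp only [map_smul, lojEv_T_pow, smul_eq_mul]
    rw [mul_add, Finset.mul_sum]
    generalize lojEv (z.2 / ρ) hs (U z.1) = w
    simp only [div_pow]
    congr 1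
    · field_simp
    · refine Finset.sum_congr rfl fun i _ => ?_
      field_simp

open Filter Topology
open scoped NNReal ENNReal ContDiff

/-- negligible -/
def LojNeg (U : Ultrafilter ℕ) (d a : ℕ → ℝ) : Prop := ∀ N : ℕ, ∀ᶠ k in (U : Filter ℕ), |a k| ≤ d k ^ N

section
variable {U : Ultrafilter ℕ} {d : ℕ → ℝ}

theorem LojNeg.mono (hd : ∀ k, 0 < d k) (hd0 : Tendsto d U (𝓝 0)) {a b : ℕ → ℝ}
    (hb : LojNeg U d b) (M : ℝ) (h : ∀ᶠ k in (U : Filter ℕ), |a k| ≤ M * |b k|) : LojNeg U d a := by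
  intro N
  have h1 : ∀ᶠ k in (U : Filter ℕ), (|M| + 1) * d k < 1 := by
    have : Tendsto (fun k => (|M| + 1) * d k) U (𝓝 ((|M|+1) * 0)) := hd0.const_mul _
    rw [mul_zero] at this
    exact this.eventually_lt_const one_pos
  filter_upwards [h, h1, hb (N+1)] with k h2 h3 h4
  have h5 : M ≤ |M| + 1 := by linarith [le_abs_self M]
  have h6 : 0 < d k ^ N := pow_pos (hd k) N
  calc |a k| ≤ M * |b k| := h2
    _ ≤ (|M| + 1) * |b k| := by gcongr
    _ ≤ (|M| + 1) * d k ^ (N+1) := by gcongr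
    _ = ((|M| + 1) * d k) * d k ^ N := by ring
    _ ≤ 1 * d k ^ N := by gcongr
    _ = d k ^ N := one_mul _

theorem LojNeg.max (hd : ∀ k, 0 < d k) (hd0 : Tendsto d U (𝓝 0)) {a b : ℕ → ℝ}
    (ha : LojNeg U d a) (hb : LojNeg U d b) : LojNeg U d (fun k => max |a k| |b k|) := by
  intro N
  filter_upwards [ha N, hb N] with k h1 h2
  rw [abs_of_nonneg (le_max_of_le_left (abs_nonneg _))]
  exact max_le h1 h2

theorem LojNeg.add (hd : ∀ k, 0 < d k) (hd0 : Tendsto d U (𝓝 0)) {a b : ℕ → ℝ}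
    (ha : LojNeg U d a) (hb : LojNeg U d b) : LojNeg U d (fun k => a k + b k) := by
  refine (ha.max hd hd0 hb).mono hd hd0 2 (Eventually.of_forall fun k => ?_)
  rw [abs_of_nonneg (le_max_of_le_left (abs_nonneg _))]
  have := abs_add_le (a k) (b k)
  linarith [le_max_left |a k| |b k|, le_max_right |a k| |b k|]

theorem LojNeg.sub (hd : ∀ k, 0 < d k) (hd0 : Tendsto d U (𝓝 0)) {a b : ℕ → ℝ}
    (ha : LojNeg U d a) (hb : LojNeg U d b) : LojNeg U d (fun k => a k - b k) := by
  have hb' : LojNeg U d (fun k => - b k) := fun N => by simpa using hb N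
  simpa [sub_eq_add_neg] using ha.add hd hd0 hb'

theorem LojNeg.zero (hd : ∀ k, 0 < d k) : LojNeg U d (fun _ => 0) := by
  intro N
  refine Eventually.of_forall fun k => ?_
  simpa using (pow_pos (hd k) N).le

theorem LojNeg.sum (hd : ∀ k, 0 < d k) (hd0 : Tendsto d U (𝓝 0)) (s : Finset ℕ) (a : ℕ → ℕ → ℝ)
    (ha : ∀ i ∈ s, LojNeg U d (a i)) : LojNeg U d (fun k => ∑ i ∈ s, a i k) := by
  induction s using Finset.induction_on with
  | empty => simpa using LojNeg.zero hd
  | insert i s hi ih =>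
    simp only [Finset.sum_insert hi]
    exact (ha i (by simp)).add hd hd0 (ih fun j hj => ha j (by simp [hj]))

theorem LojNeg.mul_bdd (hd : ∀ k, 0 < d k) (hd0 : Tendsto d U (𝓝 0)) {a b : ℕ → ℝ} {c : ℝ}
    (ha : LojNeg U d a) (hb : Tendsto b U (𝓝 c)) : LojNeg U d (fun k => b k * a k) := by
  refine ha.mono hd hd0 (|c| + 1) ?_
  filter_upwards [hb.abs.eventually_le_const (lt_add_one |c|)] with k hk
  rw [abs_mul]
  gcongr

theorem LojNeg.tendsto (hd0 : Tendsto d U (𝓝 0)) {a : ℕ → ℝ}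
    (ha : LojNeg U d a) : Tendsto a U (𝓝 0) := by
  rw [tendsto_zero_iff_abs_tendsto_zero]
  refine squeeze_zero' (Eventually.of_forall fun k => abs_nonneg _) ?_ hd0
  simpa using ha 1

theorem LojNeg.lower {a : ℕ → ℝ} (ha : ¬ LojNeg U d a) :
    ∃ N : ℕ, ∀ᶠ k in (U : Filter ℕ), d k ^ N < |a k| := by
  unfold LojNeg at ha
  push Not at ha
  obtain ⟨N, hN⟩ := ha
  exact ⟨N, hN⟩

/-- difference of values of analytic function -/
theorem LojNeg.analytic {V : Type*} [NormedAddCommGroup V] [NormedSpace ℝ V]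
    (hd : ∀ k, 0 < d k) (hd0 : Tendsto d U (𝓝 0)) {g : V → ℝ} (hg : AnalyticAt ℝ g 0)
    {x y : ℕ → V} (hx : Tendsto x U (𝓝 0)) (hy : Tendsto y U (𝓝 0))
    (hxy : LojNeg U d (fun k => ‖y k - x k‖)) : LojNeg U d (fun k => g (y k) - g (x k)) := by
  obtain ⟨K, t, ht, hK⟩ := (hg.contDiffAt (n := 1)).exists_lipschitzOnWith
  refine hxy.mono hd hd0 K ?_
  filter_upwards [hx.eventually ht, hy.eventually ht] with k h1 h2
  have := hK.dist_le_mul _ h2 _ h1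
  rw [Real.dist_eq, dist_eq_norm] at this
  simpa using this

theorem LojNeg.tendsto_of {V : Type*} [NormedAddCommGroup V]
    (hd0 : Tendsto d U (𝓝 0)) 
    {x y : ℕ → V} (hx : Tendsto x U (𝓝 0)) 
    (hxy : LojNeg U d (fun k => ‖y k - x k‖)) : Tendsto y U (𝓝 0) := by
  have h1 := tendsto_zero_iff_norm_tendsto_zero.2 (hxy.tendsto hd0)
  simpa using h1.add hx
end

theorem loj_newton (g g' : ℝ → ℝ) (hg : ∀ s, HasDerivAt g (g' s) s) (t β L δ η : ℝ) (hβ : 0 < β)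
    (hL : ∀ s, |s - t| ≤ δ → |g' s - g' t| ≤ L * |s - t|) (hL0 : 0 ≤ L) (hb : β ≤ |g' t|)
    (hη : η = 2 * |g t| / β) (h1 : η ≤ δ) (h2 : L * η ≤ β / 2) : ∃ s, |s - t| ≤ η ∧ g s = 0 := by
  wlog hpos : 0 ≤ g' t generalizing g g'
  · obtain ⟨s, hs, hs'⟩ := this (fun s => - g s) (fun s => - g' s) (fun s => (hg s).neg)
      (fun s hs => by rw [← abs_neg]; simpa [add_comm, sub_eq_add_neg] using hL s hs) (by simpa using hb) (by simpa using hη)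
      (by linarith)
    exact ⟨s, hs, by simpa using hs'⟩
  rw [abs_of_nonneg hpos] at hb
  have hη0 : 0 ≤ η := by rw [hη]; positivity
  have hd : ∀ s ∈ Set.Icc (t - η) (t + η), β / 2 ≤ g' s := by
    intro s hs
    have h3 : |s - t| ≤ η := abs_le.2 ⟨by linarith [hs.1], by linarith [hs.2]⟩
    have h4 := hL s (h3.trans h1)
    have h5 : L * |s - t| ≤ L * η := by gcongr
    have := (abs_le.1 h4).1
    linarith
  have hcont : Continuous g := continuous_iff_continuousAt.2 fun s => (hg s).continuousAt
  have hmv : ∀ a ∈ Set.Icc (t - η) (t + η), ∀ b ∈ Set.Icc (t - η) (t + η), a ≤ b → β / 2 * (b - a) ≤ g b - g a := by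
    apply (convex_Icc (t - η) (t + η)).mul_sub_le_image_sub_of_le_deriv hcont.continuousOn
      (fun s _ => (hg s).differentiableAt.differentiableWithinAt)
    intro s hs
    rw [(hg s).deriv]
    exact hd s (interior_subset hs)
  have he : β / 2 * η = |g t| := by rw [hη]; field_simp
  have u1 := hmv (t - η) ⟨le_rfl, by linarith⟩ t ⟨by linarith, by linarith⟩ (by linarith)
  have u2 := hmv t ⟨by linarith, by linarith⟩ (t + η) ⟨by linarith, le_rfl⟩ (by linarith)
  have u3 : g (t - η) ≤ 0 := by
    have : t - (t - η) = η := by ring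
    rw [this, he] at u1
    linarith [le_abs_self (g t)]
  have u4 : 0 ≤ g (t + η) := by
    have : t + η - t = η := by ring
    rw [this, he] at u2
    linarith [neg_abs_le (g t)]
  obtain ⟨s, hs, hs0⟩ := intermediate_value_Icc (by linarith : t - η ≤ t + η) hcont.continuousOn ⟨u3, u4⟩
  exact ⟨s, abs_le.2 ⟨by linarith [hs.1], by linarith [hs.2]⟩, hs0⟩

open Polynomial in
theorem loj_pseudo {R : Type*} [CommRing R] (P : R[X]) (j : ℕ) (hP : ∀ i > j, P.coeff i = 0) (n : ℕ) :
    ∀ F : R[X], (∀ i ≥ n, F.coeff i = 0) → ∃ (k : ℕ) (Q S : R[X]),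
      C (P.coeff j) ^ k * F = Q * P + S ∧ ∀ i ≥ j, S.coeff i = 0 := by
  induction n with
  | zero => 
    intro F hF
    exact ⟨0, 0, F, by simp, fun i _ => hF i (Nat.zero_le _)⟩
  | succ n ih =>
    intro F hF
    by_cases hn : n < j
    · exact ⟨0, 0, F, by simp, fun i hi => hF i (by omega)⟩
    push Not at hn
    obtain ⟨k, Q, S, h1, h2⟩ := ih (C (P.coeff j) * F - C (F.coeff n) * X ^ (n - j) * P) (by
      intro i hi
      rw [coeff_sub, coeff_C_mul, mul_assoc, coeff_C_mul, coeff_X_pow_mul']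
      rw [if_pos (by omega)]
      rcases eq_or_lt_of_le hi with rfl | hlt
      · rw [Nat.sub_sub_self hn]; ring
      · rw [hF i (by omega), hP (i - (n - j)) (by omega)]; simp)
    refine ⟨k + 1, Q + C (P.coeff j) ^ k * (C (F.coeff n) * X ^ (n - j)), S, ?_, h2⟩
    linear_combination h1

open Filter Topology
open scoped NNReal ENNReal ContDiff

theorem LojNeg.div_pow {U : Ultrafilter ℕ} {d : ℕ → ℝ} (hd : ∀ k, 0 < d k) {a : ℕ → ℝ}
    (ha : LojNeg U d a) (N : ℕ) : LojNeg U d (fun k => a k / d k ^ N) := by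
  intro M
  filter_upwards [ha (M + N)] with k hk
  have h := pow_pos (hd k) N
  rw [abs_div, abs_of_pos h, div_le_iff₀ h, ← pow_add]
  exact hk

/-- The inductive statement. -/
def LojP (E : Type*) [NormedAddCommGroup E] [NormedSpace ℝ E] : Prop :=
  ∀ (U : Ultrafilter ℕ) (d : ℕ → ℝ), (∀ k, 0 < d k) → Tendsto d U (𝓝 0) →
    ∀ (x : ℕ → E), Tendsto x U (𝓝 0) → ∀ f : E → ℝ, AnalyticAt ℝ f 0 →
      LojNeg U d (fun k => f (x k)) →
      ∃ y : ℕ → E, LojNeg U d (fun k => ‖y k - x k‖) ∧ ∀ᶠ k in (U : Filter ℕ), f (y k) = 0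

section Reg
variable (E : Type*) [NormedAddCommGroup E] [NormedSpace ℝ E]

/-- Functions analytic at the origin. -/
def lojA : Subring (E → ℝ) where
  carrier := {g | AnalyticAt ℝ g 0}
  mul_mem' := fun ha hb => AnalyticAt.mul ha hb
  one_mem' := analyticAt_const
  add_mem' := fun ha hb => AnalyticAt.add ha hb
  zero_mem' := analyticAt_const
  neg_mem' := fun ha => AnalyticAt.neg ha

variable {E}

/-- evaluation -/
noncomputable def lojEA (x : E) : lojA E →+* ℝ := (Pi.evalRingHom (fun _ : E => ℝ) x).comp (lojA E).subtype

theorem lojEA_apply (x : E) (a : lojA E) : lojEA x a = a.1 x := rfl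

/-- polynomial evaluation -/
noncomputable def lojPE (P : Polynomial (lojA E)) (x : E) (t : ℝ) : ℝ := P.eval₂ (lojEA x) t

open Polynomial in
theorem lojPE_sum (P : (lojA E)[X]) (n : ℕ) (h : ∀ i ≥ n, P.coeff i = 0) (x : E) (t : ℝ) :
    lojPE P x t = ∑ i ∈ Finset.range n, (P.coeff i).1 x * t ^ i := by
  unfold lojPE
  rcases Nat.eq_zero_or_pos n with rfl | hn
  · have : P = 0 := by ext i; simp [h i (Nat.zero_le _)]
    simp [this]
  · rw [eval₂_eq_sum_range' _ (n := n)]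
    · rfl
    · have : P.natDegree ≤ n - 1 := natDegree_le_iff_coeff_eq_zero.2 fun i hi => h i (by omega)
      omega

open Polynomial in
theorem lojPE_analytic (P : (lojA E)[X]) : AnalyticAt ℝ (fun z : E × ℝ => lojPE P z.1 z.2) 0 := by
  have h : (fun z : E × ℝ => lojPE P z.1 z.2) =
      fun z => ∑ i ∈ Finset.range (P.natDegree + 1), (P.coeff i).1 z.1 * z.2 ^ i := by
    funext z
    exact lojPE_sum P _ (fun i hi => coeff_eq_zero_of_natDegree_lt (by omega)) _ _
  rw [h]
  refine Finset.analyticAt_fun_sum _ fun i _ => ?_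
  have h1 : AnalyticAt ℝ (P.coeff i).1 ((0 : E × ℝ).1) := (P.coeff i).2
  exact (h1.comp analyticAt_fst).mul (analyticAt_snd.pow i)

open Polynomial in
theorem lojPE_deriv (P : (lojA E)[X]) (x : E) (t : ℝ) :
    HasDerivAt (lojPE P x) (lojPE (derivative P) x t) t := by
  have h : lojPE P x = fun t => (P.map (lojEA x)).eval t := by
    funext t; rw [eval_map]; rfl
  have h2 : lojPE (derivative P) x t = (derivative (P.map (lojEA x))).eval t := by
    rw [derivative_map, eval_map]; rfl
  rw [h, h2]
  exact Polynomial.hasDerivAt _ _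

open Polynomial in
theorem loj_coeffs_neg {U : Ultrafilter ℕ} {d : ℕ → ℝ} (hd : ∀ k, 0 < d k) (hd0 : Tendsto d U (𝓝 0))
    (x : ℕ → E) (t : ℕ → ℝ) (ht : Tendsto t U (𝓝 0)) (j : ℕ)
    (hmin : ∀ i < j, ¬ ∃ P : (lojA E)[X], (∀ l > i, P.coeff l = 0) ∧
      ¬ LojNeg U d (fun k => (P.coeff i).1 (x k)) ∧ LojNeg U d (fun k => lojPE P (x k) (t k)))
    (n : ℕ) : n ≤ j → ∀ R : (lojA E)[X], (∀ i ≥ n, R.coeff i = 0) →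
      LojNeg U d (fun k => lojPE R (x k) (t k)) → ∀ i, LojNeg U d (fun k => (R.coeff i).1 (x k)) := by
  induction n with
  | zero =>
    intro _ R hR _ i
    rw [hR i (Nat.zero_le _)]
    exact LojNeg.zero hd
  | succ n ih =>
    intro hn R hR hneg i
    have h1 : LojNeg U d (fun k => (R.coeff n).1 (x k)) := by
      by_contra hcon
      exact hmin n (by omega) ⟨R, fun l hl => hR l hl, hcon, hneg⟩
    rcases lt_trichotomy i n with hi | hi | hi
    · have h2 := ih (by omega) (R - C (R.coeff n) * X ^ n) (by
        intro l hl
        rw [coeff_sub, coeff_C_mul, coeff_X_pow]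
        rcases eq_or_lt_of_le hl with rfl | hl
        · simp
        · rw [hR l hl, if_neg (by omega)]; simp) (by
        have h3 : (fun k => lojPE (R - C (R.coeff n) * X ^ n) (x k) (t k)) =
          fun k => lojPE R (x k) (t k) - t k ^ n * (R.coeff n).1 (x k) := by
          funext k
          unfold lojPE
          rw [eval₂_sub, eval₂_mul, eval₂_C, eval₂_X_pow, lojEA_apply, mul_comm (t k ^ n)]
        rw [h3]
        exact hneg.sub hd hd0 (h1.mul_bdd hd hd0 (ht.pow n))) i
      rw [coeff_sub, coeff_C_mul, coeff_X_pow, if_neg (by omega)] at h2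
      simpa using h2
    · rw [hi]; exact h1
    · rw [hR i hi]; exact LojNeg.zero hd

open Polynomial in
theorem loj_poly_step (hE : LojP E) {U : Ultrafilter ℕ} {d : ℕ → ℝ} (hd : ∀ k, 0 < d k)
    (hd0 : Tendsto d U (𝓝 0))
    (x : ℕ → E) (hx : Tendsto x U (𝓝 0)) (t : ℕ → ℝ) (ht : Tendsto t U (𝓝 0))
    (P0 : (lojA E)[X]) (m : ℕ) (hP0 : ∀ i > m, P0.coeff i = 0) (hm : P0.coeff m = 1)
    (hneg : LojNeg U d (fun k => lojPE P0 (x k) (t k))) :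
    ∃ (y : ℕ → E) (s : ℕ → ℝ), LojNeg U d (fun k => ‖y k - x k‖) ∧ LojNeg U d (fun k => s k - t k) ∧
      ∀ᶠ k in (U : Filter ℕ), lojPE P0 (y k) (s k) = 0 := by
  classical
  have hex : ∃ j, ∃ P : (lojA E)[X], (∀ l > j, P.coeff l = 0) ∧
      ¬ LojNeg U d (fun k => (P.coeff j).1 (x k)) ∧ LojNeg U d (fun k => lojPE P (x k) (t k)) := by
    refine ⟨m, P0, hP0, ?_, hneg⟩
    rw [hm]
    intro h
    have := h.tendsto hd0
    have h2 : Tendsto (fun _ : ℕ => (1:ℝ)) (U : Filter ℕ) (𝓝 0) := this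
    exact one_ne_zero (tendsto_nhds_unique tendsto_const_nhds h2)
  obtain ⟨j, ⟨P, hPj, hPc, hPn⟩, hmin⟩ : ∃ j, (∃ P : (lojA E)[X], (∀ l > j, P.coeff l = 0) ∧
      ¬ LojNeg U d (fun k => (P.coeff j).1 (x k)) ∧ LojNeg U d (fun k => lojPE P (x k) (t k))) ∧
      ∀ i < j, ¬ ∃ P : (lojA E)[X], (∀ l > i, P.coeff l = 0) ∧
      ¬ LojNeg U d (fun k => (P.coeff i).1 (x k)) ∧ LojNeg U d (fun k => lojPE P (x k) (t k)) :=
    ⟨Nat.find hex, Nat.find_spec hex, fun i hi => Nat.find_min hex hi⟩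
  have hxt : Tendsto (fun k => (x k, t k)) U (𝓝 (0 : E × ℝ)) := hx.prodMk_nhds ht
  have hj : 1 ≤ j := by
    by_contra h0
    have : j = 0 := by omega
    subst this
    apply hPc
    have h1 : (fun k => lojPE P (x k) (t k)) = fun k => (P.coeff 0).1 (x k) := by
      funext k
      rw [lojPE_sum P 1 (fun i hi => hPj i hi)]; simp
    rwa [h1] at hPn
  -- derivative
  have hP'n : ¬ LojNeg U d (fun k => lojPE (derivative P) (x k) (t k)) := by
    intro h
    refine hmin (j-1) (by omega) ⟨derivative P, ?_, ?_, h⟩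
    · intro l hl
      rw [coeff_derivative, hPj _ (by omega), zero_mul]
    · rw [coeff_derivative]
      intro h2
      apply hPc
      have e : j - 1 + 1 = j := by omega
      refine h2.mono hd hd0 1 (Eventually.of_forall fun k => ?_)
      rw [e]
      have e2 : ((P.coeff j * (((j-1 : ℕ) : lojA E) + 1)).1 (x k)) = (P.coeff j).1 (x k) * j := by
        have : (((j-1 : ℕ) : lojA E) + 1) = (j : lojA E) := by
          rw [← Nat.cast_add_one, e]
        rw [this, ← lojEA_apply, map_mul, map_natCast, lojEA_apply]
      rw [e2, abs_mul, one_mul]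
      have : (1:ℝ) ≤ |(j:ℝ)| := by rw [abs_of_nonneg (by positivity)]; exact_mod_cast hj
      nlinarith [abs_nonneg ((P.coeff j).1 (x k))]
  -- pseudo division
  obtain ⟨r, Q, S, hQS, hS⟩ := loj_pseudo P j hPj (m+1) P0 (fun i hi => hP0 i hi)
  have hev : ∀ (y : E) (s : ℝ), (P.coeff j).1 y ^ r * lojPE P0 y s = lojPE Q y s * lojPE P y s + lojPE S y s := by
    intro y s
    have := congrArg (fun F => lojPE F y s) hQS
    simpa [lojPE, eval₂_add, eval₂_mul, eval₂_pow, lojEA_apply] using this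
  have hcan : ∀ a : lojA E, Tendsto (fun k => a.1 (x k)) U (𝓝 (a.1 0)) := fun a =>
    (AnalyticAt.continuousAt a.2).tendsto.comp hx
  have hSn : LojNeg U d (fun k => lojPE S (x k) (t k)) := by
    have h1 := hneg.mul_bdd hd hd0 ((hcan (P.coeff j)).pow r)
    have h2 := hPn.mul_bdd hd hd0 ((lojPE_analytic Q).continuousAt.tendsto.comp hxt)
    have h3 := h1.sub hd hd0 h2
    convert h3 using 2 with k
    have := hev (x k) (t k)
    simp only [Function.comp]
    linarith
  have hSc := loj_coeffs_neg hd hd0 x t ht j hmin j le_rfl S hS hSn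
  obtain ⟨y, hyx, hy0⟩ := hE U d hd hd0 x hx (fun v => ∑ i ∈ Finset.range j, (S.coeff i).1 v * (S.coeff i).1 v)
    (Finset.analyticAt_fun_sum _ fun i _ => AnalyticAt.mul (S.coeff i).2 (S.coeff i).2)
    (LojNeg.sum hd hd0 _ (fun i k => (S.coeff i).1 (x k) * (S.coeff i).1 (x k)) fun i _ =>
      (hSc i).mul_bdd hd hd0 (hcan (S.coeff i)))
  have hy : Tendsto y U (𝓝 0) := hyx.tendsto_of hd0 hx
  have hyt : Tendsto (fun k => (y k, t k)) U (𝓝 (0 : E × ℝ)) := hy.prodMk_nhds ht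
  have hdiff : LojNeg U d (fun k => ‖(y k, t k) - (x k, t k)‖) := by
    convert hyx using 2 with k
    simp [Prod.norm_def]
  have hS0 : ∀ᶠ k in (U : Filter ℕ), ∀ s, lojPE S (y k) s = 0 := by
    filter_upwards [hy0] with k hk s
    rw [lojPE_sum S j hS]
    rw [Finset.sum_eq_zero_iff_of_nonneg (fun i _ => mul_self_nonneg _)] at hk
    refine Finset.sum_eq_zero fun i hi => ?_
    rw [mul_self_eq_zero.1 (hk i hi), zero_mul]
  have hPy : LojNeg U d (fun k => lojPE P (y k) (t k)) := by
    have := (LojNeg.analytic hd hd0 (lojPE_analytic P) hxt hyt hdiff).add hd hd0 hPn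
    simpa using this
  have hP'y : ¬ LojNeg U d (fun k => lojPE (derivative P) (y k) (t k)) := by
    intro h
    apply hP'n
    have := h.sub hd hd0 (LojNeg.analytic hd hd0 (lojPE_analytic (derivative P)) hxt hyt hdiff)
    simpa using this
  have hcy : ¬ LojNeg U d (fun k => (P.coeff j).1 (y k)) := by
    intro h
    apply hPc
    have := h.sub hd hd0 (LojNeg.analytic hd hd0 (P.coeff j).2 hx hy hyx)
    simpa using this
  obtain ⟨N, hN⟩ := LojNeg.lower hP'y
  obtain ⟨N', hN'⟩ := LojNeg.lower hcy
  obtain ⟨K, T, hT, hK⟩ := ((lojPE_analytic (derivative P)).contDiffAt (n := 1)).exists_lipschitzOnWith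
  obtain ⟨ρ, hρ, hρT⟩ := Metric.mem_nhds_iff.1 hT
  have hη : LojNeg U d (fun k => 2 * |lojPE P (y k) (t k)| / d k ^ N) := by
    apply LojNeg.div_pow hd
    exact hPy.mono hd hd0 2 (Eventually.of_forall fun k => by simp [abs_mul])
  have hη0 := hη.tendsto hd0
  have hη1 := ((hη.div_pow hd N).tendsto hd0).const_mul (K : ℝ)
  rw [mul_zero] at hη1
  have hroot : ∀ᶠ k in (U : Filter ℕ), ∃ s, |s - t k| ≤ 2 * |lojPE P (y k) (t k)| / d k ^ N ∧
      lojPE P (y k) s = 0 := by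
    filter_upwards [hN, hη0.eventually_le_const (half_pos hρ), hη1.eventually_le_const (show (0:ℝ) < 1/2 by norm_num),
      hyt.eventually (Metric.ball_mem_nhds _ (half_pos hρ))] with k h1 h2 h3 h4
    have hdN := pow_pos (hd k) N
    rw [dist_zero_right, Prod.norm_def, max_lt_iff] at h4
    refine loj_newton (lojPE P (y k)) (lojPE (derivative P) (y k)) (lojPE_deriv P (y k)) (t k) (d k ^ N) K (ρ/2)
      _ hdN ?_ K.2 h1.le rfl h2 ?_
    · intro s hs
      have m1 : (y k, s) ∈ T := hρT (by
        rw [mem_ball_zero_iff, Prod.norm_def, max_lt_iff]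
        refine ⟨by simp only; linarith [h4.1], ?_⟩
        have := abs_sub_abs_le_abs_sub s (t k)
        have h5 := h4.2
        simp only [Real.norm_eq_abs] at h5 ⊢
        linarith)
      have m2 : (y k, t k) ∈ T := hρT (by
        rw [mem_ball_zero_iff, Prod.norm_def, max_lt_iff]
        exact ⟨by linarith [h4.1], by linarith [h4.2]⟩)
      have := hK.dist_le_mul _ m1 _ m2
      rw [Real.dist_eq, Prod.dist_eq, dist_self, max_eq_right dist_nonneg, Real.dist_eq] at this
      exact this
    · rw [← mul_div_assoc, div_le_iff₀ hdN] at h3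
      linarith
  obtain ⟨s, hs⟩ := hroot.choice
  refine ⟨y, s, hyx, ?_, ?_⟩
  · refine hη.mono hd hd0 1 ?_
    filter_upwards [hs] with k hk
    rw [one_mul]
    exact hk.1.trans (le_abs_self _)
  · filter_upwards [hs, hS0, hN'] with k h1 h2 h3
    have := hev (y k) (s k)
    rw [h1.2, h2, mul_zero, add_zero] at this
    have h4 : (P.coeff j).1 (y k) ≠ 0 := by
      intro h0
      rw [h0, abs_zero] at h3
      exact absurd h3 (not_lt.2 (pow_pos (hd k) N').le)
    exact (mul_eq_zero.1 this).resolve_left (pow_ne_zero _ h4)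
end Reg

open Filter Topology
open scoped NNReal ENNReal ContDiff

section
variable {E : Type*} [NormedAddCommGroup E] [NormedSpace ℝ E]

open Polynomial in
theorem loj_regular (hE : LojP E) {U : Ultrafilter ℕ} {d : ℕ → ℝ} (hd : ∀ k, 0 < d k)
    (hd0 : Tendsto d U (𝓝 0)) (z : ℕ → E × ℝ) (hz : Tendsto z U (𝓝 0)) (f : E × ℝ → ℝ)
    (hf : AnalyticAt ℝ f 0) (hne : ¬ ∀ᶠ t in 𝓝 (0:ℝ), f (0, t) = 0)
    (hfz : LojNeg U d (fun k => f (z k))) :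
    ∃ y : ℕ → E × ℝ, LojNeg U d (fun k => ‖y k - z k‖) ∧ ∀ᶠ k in (U : Filter ℕ), f (y k) = 0 := by
  obtain ⟨m, a, u, ε, hε, ha, hu⟩ := loj_weierstrass f hf hne
  set b : Fin m → lojA E := fun i => ⟨a i, ha i⟩ with hb
  set P0 : (lojA E)[X] := X ^ m + ∑ i : Fin m, C (b i) * X ^ (i:ℕ) with hP0
  have hev : ∀ x t, lojPE P0 x t = t ^ m + ∑ i : Fin m, a i x * t ^ (i:ℕ) := by
    intro x t
    unfold lojPE
    rw [hP0, eval₂_add, eval₂_X_pow, eval₂_finsetSum]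
    congr 1
    refine Finset.sum_congr rfl fun i _ => ?_
    rw [eval₂_mul, eval₂_C, eval₂_X_pow, lojEA_apply]
  have hco : ∀ l, P0.coeff l = (if l = m then 1 else 0) + ∑ i : Fin m, b i * (if l = (i:ℕ) then 1 else 0) := by
    intro l
    rw [hP0, coeff_add, coeff_X_pow, finsetSum_coeff]
    congr 1
    refine Finset.sum_congr rfl fun i _ => ?_
    rw [coeff_C_mul, coeff_X_pow]
  have hz1 : Tendsto (fun k => (z k).1) U (𝓝 0) := (continuous_fst.tendsto (0 : E × ℝ)).comp hz
  have hz2 : Tendsto (fun k => (z k).2) U (𝓝 0) := (continuous_snd.tendsto (0 : E × ℝ)).comp hz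
  obtain ⟨y, s, h1, h2, h3⟩ := loj_poly_step hE hd hd0 (fun k => (z k).1) hz1 (fun k => (z k).2) hz2 P0 m
    (by
      intro l hl
      rw [hco, if_neg (by omega), zero_add]
      refine Finset.sum_eq_zero fun i _ => ?_
      rw [if_neg (by have := i.2; omega), mul_zero])
    (by
      rw [hco, if_pos rfl, Finset.sum_eq_zero, add_zero]
      intro i _
      rw [if_neg (by have := i.2; omega), mul_zero])
    (by
      refine hfz.mono hd hd0 (1/ε) ?_
      filter_upwards [hz.eventually hu] with k hk
      rw [hev, hk.2, abs_mul, ← mul_assoc]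
      have : 1 ≤ 1 / ε * |u (z k)| := by
        rw [one_div, ← div_eq_inv_mul, one_le_div hε]; exact hk.1
      nlinarith [abs_nonneg ((z k).2 ^ m + ∑ i : Fin m, a i (z k).1 * (z k).2 ^ (i:ℕ))])
  have h4 : LojNeg U d (fun k => ‖(y k, s k) - z k‖) := by
    refine (h1.max hd hd0 h2).mono hd hd0 1 (Eventually.of_forall fun k => ?_)
    rw [one_mul, abs_of_nonneg (norm_nonneg _), Prod.norm_def]
    simp only [abs_norm, Prod.fst_sub, Prod.snd_sub, Real.norm_eq_abs]
    exact le_abs_self _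
  refine ⟨fun k => (y k, s k), h4, ?_⟩
  have h5 := LojNeg.tendsto_of hd0 hz h4
  filter_upwards [h3, h5.eventually hu] with k h6 h7
  rw [h7.2, ← hev, h6, mul_zero]

theorem LojP.equiv {F : Type*} [NormedAddCommGroup F] [NormedSpace ℝ F] (hE : LojP E) (e : E ≃L[ℝ] F) :
    LojP F := by
  intro U d hd hd0 x hx f hf hfx
  have h0 : e.symm (0 : F) = 0 := map_zero _
  obtain ⟨y, h1, h2⟩ := hE U d hd hd0 (fun k => e.symm (x k))
    (by have := (e.symm.continuous.tendsto 0).comp hx; rwa [h0] at this) (fun v => f (e v))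
    (by
      have h : AnalyticAt ℝ f (e (0 : E)) := by rwa [map_zero]
      exact h.comp (e.toContinuousLinearMap.analyticAt 0)) (by simpa using hfx)
  refine ⟨fun k => e (y k), ?_, h2⟩
  refine h1.mono hd hd0 ‖(e : E →L[ℝ] F)‖ (Eventually.of_forall fun k => ?_)
  rw [abs_of_nonneg (norm_nonneg _), abs_of_nonneg (norm_nonneg _)]
  have := (e : E →L[ℝ] F).le_opNorm (y k - e.symm (x k))
  simpa using this

theorem LojP.step (hE : LojP E) : LojP (E × ℝ) := by
  intro U d hd hd0 x hx f hf hfx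
  by_cases hz : ∀ᶠ v in 𝓝 (0 : E × ℝ), f v = 0
  · refine ⟨x, ?_, hx.eventually hz⟩
    simpa using LojNeg.zero hd
  obtain ⟨r, hr, hball⟩ := hf.exists_ball_analyticOnNhd
  -- find a good direction
  obtain ⟨w, s, hs, hws, hfw⟩ : ∃ (w : E) (s : ℝ), s ≠ 0 ∧ (w, s) ∈ Metric.ball (0 : E × ℝ) r ∧ f (w, s) ≠ 0 := by
    by_contra hcon
    push Not at hcon
    apply hz
    filter_upwards [Metric.ball_mem_nhds (0 : E × ℝ) hr] with v hv
    have hvs : (v.1, v.2) = v := rfl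
    by_cases hv2 : v.2 = 0
    · have hc : ContinuousAt f v := (hball v hv).continuousAt
      have ht : Tendsto (fun τ : ℝ => (v.1, τ)) (𝓝[≠] 0) (𝓝 v) := by
        have : Tendsto (fun τ : ℝ => (v.1, τ)) (𝓝 0) (𝓝 (v.1, (0:ℝ))) :=
          Continuous.tendsto (by fun_prop) 0
        rw [← hv2, hvs] at this
        rw [hv2] at this
        exact this.mono_left nhdsWithin_le_nhds
      have h1 : Tendsto (fun τ : ℝ => f (v.1, τ)) (𝓝[≠] 0) (𝓝 (f v)) := hc.tendsto.comp ht
      have h2 : ∀ᶠ τ : ℝ in 𝓝[≠] 0, f (v.1, τ) = 0 := by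
        filter_upwards [ht.eventually (Metric.isOpen_ball.mem_nhds hv), self_mem_nhdsWithin] with τ h3 h4
        exact hcon _ _ h4 h3
      exact tendsto_nhds_unique h1 ((tendsto_congr' h2).2 tendsto_const_nhds)
    · exact hcon v.1 v.2 hv2 hv
  have hreg : ¬ ∀ᶠ t in 𝓝 (0:ℝ), f (t • s⁻¹ • w, t) = 0 := by
    intro hev
    have hmem : ∀ τ ∈ Set.Icc (0:ℝ) 1, (τ • w, τ * s) ∈ Metric.ball (0 : E × ℝ) r := by
      intro τ hτ
      have : (τ • w, τ * s) = τ • (w, s) := rfl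
      rw [this, mem_ball_zero_iff, norm_smul, Real.norm_eq_abs, abs_of_nonneg hτ.1]
      rw [mem_ball_zero_iff] at hws
      nlinarith [norm_nonneg (w, s), hτ.2]
    have han : AnalyticOnNhd ℝ (fun τ : ℝ => f (τ • w, τ * s)) (Set.Icc (0:ℝ) 1) := by
      intro τ hτ
      have h1 : AnalyticAt ℝ (fun τ : ℝ => (τ • w, τ * s)) τ :=
        (analyticAt_id.smul analyticAt_const).prod (analyticAt_id.mul analyticAt_const)
      exact (hball _ (hmem τ hτ)).comp_of_eq h1 rfl
    have h0 : (fun τ : ℝ => f (τ • w, τ * s)) =ᶠ[𝓝 0] 0 := by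
      have ht : Tendsto (fun τ : ℝ => τ * s) (𝓝 0) (𝓝 0) := by
        have := (continuous_mul_const s).tendsto (0:ℝ)
        simpa using this
      filter_upwards [ht.eventually hev] with τ hτ
      rw [smul_smul, mul_assoc, mul_inv_cancel₀ hs, mul_one] at hτ
      exact hτ
    have := han.eqOn_zero_of_preconnected_of_eventuallyEq_zero isPreconnected_Icc
      (Set.left_mem_Icc.2 zero_le_one) h0 (Set.right_mem_Icc.2 zero_le_one)
    simp at this
    exact hfw this
  set v : E := s⁻¹ • w with hv
  let A : E × ℝ →L[ℝ] E × ℝ :=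
    (ContinuousLinearMap.fst ℝ E ℝ + (ContinuousLinearMap.snd ℝ E ℝ).smulRight v).prod (ContinuousLinearMap.snd ℝ E ℝ)
  let B : E × ℝ →L[ℝ] E × ℝ :=
    (ContinuousLinearMap.fst ℝ E ℝ - (ContinuousLinearMap.snd ℝ E ℝ).smulRight v).prod (ContinuousLinearMap.snd ℝ E ℝ)
  have hA : ∀ z, A z = (z.1 + z.2 • v, z.2) := fun z => rfl
  have hB : ∀ z, B z = (z.1 - z.2 • v, z.2) := fun z => rfl
  have hAB : ∀ z, A (B z) = z := fun z => by rw [hA, hB]; simp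
  obtain ⟨y, h1, h2⟩ := loj_regular hE hd hd0 (fun k => B (x k))
    (by have := (B.continuous.tendsto 0).comp hx; rwa [map_zero] at this) (fun z => f (A z))
    (by
      have h : AnalyticAt ℝ f (A 0) := by rwa [map_zero]
      exact h.comp (A.analyticAt 0))
    (by simpa [hA] using hreg) (by simpa [hAB] using hfx)
  refine ⟨fun k => A (y k), ?_, h2⟩
  refine h1.mono hd hd0 ‖A‖ (Eventually.of_forall fun k => ?_)
  rw [abs_of_nonneg (norm_nonneg _), abs_of_nonneg (norm_nonneg _)]
  have := A.le_opNorm (y k - B (x k))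
  rwa [map_sub, hAB] at this

theorem LojP.base [Subsingleton E] : LojP E := by
  intro U d hd hd0 x hx f hf hfx
  refine ⟨x, by simpa using LojNeg.zero hd, ?_⟩
  have h1 : (fun k => f (x k)) = fun _ => f 0 := by
    funext k; rw [Subsingleton.elim (x k) 0]
  have h2 := hfx.tendsto hd0
  rw [h1] at h2
  have h3 : f 0 = 0 := tendsto_nhds_unique tendsto_const_nhds h2
  refine Eventually.of_forall fun k => ?_
  rw [Subsingleton.elim (x k) 0, h3]
end

theorem lojP_euclidean (n : ℕ) : LojP (EuclideanSpace ℝ (Fin n)) := by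
  induction n with
  | zero => exact LojP.base
  | succ n ih =>
    exact ih.step.equiv (ContinuousLinearEquiv.ofFinrankEq (by simp))

/-- Łojasiewicz distance inequality. If `f : ℝⁿ → ℝ` is nonnegative,
real analytic, and `p` is a critical point with `f p = 0`, then near `p` one has
`f x ≥ C · dist(x, S)^α` where `S` is the critical set of `f`. -/
theorem lojasiewicz_distance_inequality
    (n : ℕ)
    (f : EuclideanSpace ℝ (Fin n) → ℝ)
    (hf : ∀ x, AnalyticAt ℝ f x)
    (hnonneg : ∀ x, 0 ≤ f x)
    (p : EuclideanSpace ℝ (Fin n))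
    (hfp : f p = 0)
    (hcrit : gradient f p = 0) :
    ∃ U ∈ nhds p, ∃ C : ℝ, 0 < C ∧ ∃ α : ℝ, 2 ≤ α ∧
      ∀ x ∈ U,
        C * Metric.infDist x {z : EuclideanSpace ℝ (Fin n) | gradient f z = 0} ^ α
          ≤ f x := by
  by_contra hcon
  push Not at hcon
  set S := {z : EuclideanSpace ℝ (Fin n) | gradient f z = 0} with hS
  have hk : ∀ k : ℕ, ∃ x, x ∈ Metric.ball p (1 / ((k:ℝ) + 1)) ∧ f x < Metric.infDist x S ^ (k + 2) := by
    intro k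
    obtain ⟨x, hx, h⟩ := hcon (Metric.ball p (1 / ((k:ℝ) + 1))) (Metric.ball_mem_nhds _ (by positivity)) 1 one_pos
      ((k + 2 : ℕ) : ℝ) (by push_cast; linarith [Nat.cast_nonneg (α := ℝ) k])
    rw [one_mul, Real.rpow_natCast] at h
    exact ⟨x, hx, h⟩
  choose x hxb hxf using hk
  have hpS : p ∈ S := hcrit
  have hdpos : ∀ k, 0 < Metric.infDist (x k) S := by
    intro k
    refine lt_of_le_of_ne Metric.infDist_nonneg fun h => ?_
    have := hxf k
    rw [← h, zero_pow (by omega)] at this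
    exact absurd this (not_lt.2 (hnonneg _))
  have hxp : Tendsto (fun k => ‖x k - p‖) atTop (𝓝 0) := by
    refine squeeze_zero (fun k => norm_nonneg _) (fun k => ?_) tendsto_one_div_add_atTop_nhds_zero_nat
    have := hxb k
    rw [Metric.mem_ball, dist_eq_norm] at this
    exact this.le
  have hd0 : Tendsto (fun k => Metric.infDist (x k) S) atTop (𝓝 0) := by
    refine squeeze_zero (fun k => (hdpos k).le) (fun k => ?_) hxp
    rw [← dist_eq_norm]
    exact Metric.infDist_le_dist_of_mem hpS
  let U : Ultrafilter ℕ := hyperfilter ℕ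
  have hU : (U : Filter ℕ) ≤ atTop := Nat.hyperfilter_le_atTop
  have hfa : AnalyticAt ℝ (fun v => f (p + v)) 0 := by
    have h : AnalyticAt ℝ f (p + 0) := hf _
    exact h.comp (f := fun v => p + v) (analyticAt_const.add analyticAt_id)
  obtain ⟨y, h1, h2⟩ := lojP_euclidean n U (fun k => Metric.infDist (x k) S) hdpos (hd0.mono_left hU)
    (fun k => x k - p) ((tendsto_zero_iff_norm_tendsto_zero.2 hxp).mono_left hU) (fun v => f (p + v)) hfa (by
      intro N
      apply hU
      filter_upwards [hd0.eventually_le_const one_pos, eventually_ge_atTop N] with k hk1 hk2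
      simp only [add_sub_cancel]
      rw [abs_of_nonneg (hnonneg _)]
      exact (hxf k).le.trans (pow_le_pow_of_le_one (hdpos k).le hk1 (by omega)))
  obtain ⟨k, h3, h4, h5⟩ := (((h1 2).and (h2.and ((hd0.mono_left hU).eventually_lt_const one_pos)))).exists
  have hcr : p + y k ∈ S := by
    have hmin : IsLocalMin f (p + y k) := Eventually.of_forall fun z => by
      rw [h4]; exact hnonneg z
    show gradient f (p + y k) = 0
    unfold gradient
    rw [hmin.fderiv_eq_zero, map_zero]
  have h6 := Metric.infDist_le_dist_of_mem (x := x k) hcr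
  have h7 : dist (x k) (p + y k) = ‖y k - (x k - p)‖ := by
    rw [dist_comm, dist_eq_norm]; congr 1; abel
  rw [abs_of_nonneg (norm_nonneg _), ← h7] at h3
  nlinarith [hdpos k]
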